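/- Let G be a finite simple graph on vertex set V and let P be a real number with P > 1. For x : V → {0,1} define, for each vertex v of degree d_v: if d_v = 0, p_v = (1 − x(v))²; if d_v = 1 with unique neighbor u, p_v = (1 − (x(v) + x(u)) + x(v)·x(u))²; if d_v ≥ 2, p_v(y) = (1 − (x(v) + Σ_{u ∈ N(v)} x(u)) + S_v(y))², where S_v(y) = Σ_{k=0}^{L_v−1} 2^k · y(v,k) + (d_v + 1 − 2^{L_v}) · y(v,L_v), L_v = ⌊log₂ d_v⌋, and y(v,k) ∈ {0,1}. Then the minimum over all x and all surplus assignments y of F(x,y) = Σ_{v ∈ V} x(v) + P · Σ_{v ∈ V} p_v equals the domination number γ(G), and for every minimizer (x*, y*) the set {v ∈ V : x*(v) = 1} is a minimum dominating set of G. -/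

import Mathlib

open Finset

/-- A finset `D` is a dominating set of `G` if every vertex is in `D`
or adjacent to at least one vertex of `D`. -/
def IsDominatingSet {V : Type*} (G : SimpleGraph V) (D : Finset V) : Prop :=
  ∀ v, v ∈ D ∨ ∃ u ∈ D, G.Adj v u

/-- The domination number: the minimum cardinality of a dominating set of `G`. -/
noncomputable def dominationNumber {V : Type*} [Fintype V] (G : SimpleGraph V) : ℕ :=
  sInf {k | ∃ D : Finset V, IsDominatingSet G D ∧ D.card = k}

/-- The Pan–Lu penalty term for a vertex `v` of degree `d_v`:
if `d_v = 0`, `(1 - x v)²`; if `d_v = 1` with unique neighbor `u`,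
`(1 - (x v + x u) + x v · x u)²` (here `x u = ∑_{u ∈ N(v)} x u` since `|N(v)| = 1`);
if `d_v ≥ 2`, `(1 - (x v + ∑_{u ∈ N(v)} x u) + S_v(y))²` where
`S_v(y) = ∑_{k=0}^{L_v - 1} 2^k y(v,k) + (d_v + 1 - 2^{L_v}) y(v, L_v)` and
`L_v = ⌊log₂ d_v⌋`. -/
def panLuPenalty {V : Type*} [Fintype V] (G : SimpleGraph V)
    [DecidableRel G.Adj] (x : V → ℤ) (y : V → ℕ → ℤ) (v : V) : ℤ :=
  if G.degree v = 0 then (1 - x v) ^ 2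
  else if G.degree v = 1 then
    (1 - (x v + ∑ u ∈ G.neighborFinset v, x u) +
      x v * ∑ u ∈ G.neighborFinset v, x u) ^ 2
  else
    (1 - (x v + ∑ u ∈ G.neighborFinset v, x u) +
      (∑ k ∈ Finset.range (Nat.log 2 (G.degree v)), 2 ^ k * y v k +
        ((G.degree v : ℤ) + 1 - 2 ^ (Nat.log 2 (G.degree v))) *
          y v (Nat.log 2 (G.degree v)))) ^ 2

/-- The Pan–Lu QUBO objective `F(x,y) = ∑_v x v + P ∑_v p_v`, evaluated in `ℝ`. -/
noncomputable def panLuF {V : Type*} [Fintype V] (G : SimpleGraph V)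
    [DecidableRel G.Adj] (P : ℝ) (x : V → ℤ) (y : V → ℕ → ℤ) : ℝ :=
  (∑ v, (x v : ℝ)) + P * ∑ v, ((panLuPenalty G x y v : ℤ) : ℝ)

/-- Binary weights `1, 2, …, 2 ^ (L - 1)` together with one extra weight `c ≤ 2 ^ L` represent every
natural number below `2 ^ L + c`. -/
theorem exists_binary_sum_add_mul_eq (L c n : ℕ) (hc : c ≤ 2 ^ L) (hn : n < 2 ^ L + c) :
    ∃ y : ℕ → ℤ, (∀ k, y k = 0 ∨ y k = 1) ∧
      ∑ k ∈ Finset.range L, 2 ^ k * y k + (c : ℤ) * y L = n := by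
  induction L generalizing c n with
  | zero =>
    simp only [pow_zero] at hc hn
    obtain rfl | ⟨rfl, rfl⟩ : n = 0 ∨ n = 1 ∧ c = 1 := by omega
    · exact ⟨fun _ => 0, by simp, by simp⟩
    · exact ⟨fun _ => 1, by simp, by simp⟩
  | succ L ih =>
    obtain ⟨b, m, hb, hm, hbm⟩ : ∃ (b : ℤ) (m : ℕ), (b = 0 ∨ b = 1) ∧ m < 2 ^ L + 2 ^ L ∧
        (m : ℤ) + c * b = n := by
      rw [pow_succ] at hc hn
      by_cases h : n < 2 ^ L + 2 ^ L
      · exact ⟨0, n, by simp, h, by simp⟩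
      · exact ⟨1, n - c, by simp, by omega, by omega⟩
    obtain ⟨y, hy, hsum⟩ := ih (2 ^ L) m le_rfl hm
    refine ⟨Function.update y (L + 1) b, fun k => ?_, ?_⟩
    · rcases eq_or_ne k (L + 1) with rfl | hk
      · simpa using hb
      · simpa [hk] using hy k
    · have hcongr : ∑ k ∈ Finset.range (L + 1), 2 ^ k * Function.update y (L + 1) b k =
          ∑ k ∈ Finset.range (L + 1), 2 ^ k * y k :=
        Finset.sum_congr rfl fun k hk => by
          rw [Function.update_of_ne (Finset.mem_range.mp hk).ne]
      rw [hcongr, Finset.sum_range_succ, Function.update_self, ← hbm, ← hsum]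
      push_cast
      ring

section Domination

variable {V : Type*} [Fintype V] {G : SimpleGraph V}

theorem dominationNumber_le_card {D : Finset V} (hD : IsDominatingSet G D) :
    dominationNumber G ≤ D.card :=
  Nat.sInf_le ⟨D, hD, rfl⟩

variable (G) in
theorem exists_isDominatingSet_card_eq_dominationNumber :
    ∃ D : Finset V, IsDominatingSet G D ∧ D.card = dominationNumber G :=
  Nat.sInf_mem (s := {k | ∃ D : Finset V, IsDominatingSet G D ∧ D.card = k})
    ⟨_, Finset.univ, fun v => Or.inl (Finset.mem_univ v), rfl⟩

end Domination

section Penalty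

variable {V : Type*} [Fintype V] {G : SimpleGraph V} [DecidableRel G.Adj]
  {x : V → ℤ} {y : V → ℕ → ℤ}

theorem panLuPenalty_nonneg (v : V) : 0 ≤ panLuPenalty G x y v := by
  unfold panLuPenalty
  split_ifs <;> positivity

/-- A vertex that is neither selected nor adjacent to a selected vertex is penalized. -/
theorem one_le_panLuPenalty (hy : ∀ v k, y v k = 0 ∨ y v k = 1) {v : V} (hv : x v = 0)
    (hN : ∀ u, G.Adj v u → x u = 0) : 1 ≤ panLuPenalty G x y v := by
  have hsum : ∑ u ∈ G.neighborFinset v, x u = 0 :=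
    Finset.sum_eq_zero fun u hu => hN u ((G.mem_neighborFinset v u).mp hu)
  have hy0 : ∀ k, 0 ≤ y v k := fun k => by rcases hy v k with h | h <;> simp [h]
  unfold panLuPenalty
  rw [hsum, hv]
  split_ifs with h0 h1
  · norm_num
  · norm_num
  · have hpow : (2 : ℤ) ^ Nat.log 2 (G.degree v) ≤ G.degree v := by
      exact_mod_cast Nat.pow_log_le_self 2 h0
    have hS : 0 ≤ ∑ k ∈ Finset.range (Nat.log 2 (G.degree v)), 2 ^ k * y v k :=
      Finset.sum_nonneg fun k _ => mul_nonneg (by positivity) (hy0 k)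
    have hT : 0 ≤ ((G.degree v : ℤ) + 1 - 2 ^ (Nat.log 2 (G.degree v))) *
        y v (Nat.log 2 (G.degree v)) :=
      mul_nonneg (by linarith) (hy0 _)
    exact one_le_pow₀ (by linarith)

/-- At a dominated vertex the surplus bits can be chosen so that the penalty vanishes. -/
theorem exists_surplus_panLuPenalty_eq_zero (hx : ∀ v, x v = 0 ∨ x v = 1) {v : V}
    (hv : x v = 1 ∨ ∃ u, G.Adj v u ∧ x u = 1) :
    ∃ z : ℕ → ℤ, (∀ k, z k = 0 ∨ z k = 1) ∧
      ∀ y : V → ℕ → ℤ, y v = z → panLuPenalty G x y v = 0 := by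
  have hx0 : ∀ u, 0 ≤ x u := fun u => by rcases hx u with h | h <;> simp [h]
  have hx1 : ∀ u, x u ≤ 1 := fun u => by rcases hx u with h | h <;> simp [h]
  have hsum0 : 0 ≤ ∑ u ∈ G.neighborFinset v, x u := Finset.sum_nonneg fun u _ => hx0 u
  have hsumd : ∑ u ∈ G.neighborFinset v, x u ≤ G.degree v := by
    simpa using Finset.sum_le_card_nsmul (G.neighborFinset v) x 1 fun u _ => hx1 u
  have hdom : x v = 1 ∨ 1 ≤ ∑ u ∈ G.neighborFinset v, x u := by
    refine hv.imp_right fun ⟨u, hu, hxu⟩ => ?_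
    rw [← hxu]
    exact Finset.single_le_sum (fun w _ => hx0 w) ((G.mem_neighborFinset v u).mpr hu)
  unfold panLuPenalty
  generalize ∑ u ∈ G.neighborFinset v, x u = s at hsum0 hsumd hdom ⊢
  split_ifs with h0 h1
  · refine ⟨fun _ => 0, by simp, fun y _ => ?_⟩
    have : x v = 1 := by
      rw [h0] at hsumd
      norm_num at hsumd
      exact hdom.resolve_right (by omega)
    simp [this]
  · refine ⟨fun _ => 0, by simp, fun y _ => ?_⟩
    rw [h1] at hsumd
    norm_num at hsumd
    rcases hdom with h | h
    · simp [h]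
    · obtain rfl : s = 1 := le_antisymm hsumd h
      simp
  · have hlow : 2 ^ Nat.log 2 (G.degree v) ≤ G.degree v := Nat.pow_log_le_self 2 h0
    have hupp : G.degree v < 2 ^ Nat.log 2 (G.degree v) * 2 := by
      rw [← pow_succ]
      exact Nat.lt_pow_succ_log_self one_lt_two _
    have hxv0 := hx0 v
    have hxv1 := hx1 v
    obtain ⟨z, hz, hzsum⟩ := exists_binary_sum_add_mul_eq (Nat.log 2 (G.degree v))
      (G.degree v + 1 - 2 ^ Nat.log 2 (G.degree v)) (x v + s - 1).toNat
      (by omega) (by omega)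
    refine ⟨z, hz, fun y hyz => ?_⟩
    rw [Nat.cast_sub (by omega), Int.toNat_of_nonneg (by omega)] at hzsum
    push_cast at hzsum
    rw [hyz, hzsum]
    ring

theorem sum_eq_card_filter_eq_one (hx : ∀ v, x v = 0 ∨ x v = 1) :
    ∑ v, (x v : ℝ) = ((Finset.univ.filter fun v => x v = 1).card : ℝ) := by
  rw [← Finset.sum_boole]
  refine Finset.sum_congr rfl fun v _ => ?_
  rcases hx v with h | h <;> simp [h]

/-- A minimum dominating set yields a binary assignment attaining the domination number. -/
theorem exists_panLuF_eq_dominationNumber (G : SimpleGraph V) [DecidableRel G.Adj] (P : ℝ) :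
    ∃ (x : V → ℤ) (y : V → ℕ → ℤ), (∀ v, x v = 0 ∨ x v = 1) ∧ (∀ v k, y v k = 0 ∨ y v k = 1) ∧
      panLuF G P x y = dominationNumber G := by
  classical
  obtain ⟨D, hD, hcard⟩ := exists_isDominatingSet_card_eq_dominationNumber G
  set x : V → ℤ := fun v => if v ∈ D then 1 else 0 with hxdef
  have hx : ∀ v, x v = 0 ∨ x v = 1 := fun v => by by_cases h : v ∈ D <;> simp [hxdef, h]
  have hdom : ∀ v, x v = 1 ∨ ∃ u, G.Adj v u ∧ x u = 1 := fun v =>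
    (hD v).imp (fun h => by simp [hxdef, h]) fun ⟨u, hu, hvu⟩ => ⟨u, hvu, by simp [hxdef, hu]⟩
  choose y hy hpen using fun v => exists_surplus_panLuPenalty_eq_zero hx (hdom v)
  refine ⟨x, y, hx, hy, ?_⟩
  have hfilter : (Finset.univ.filter fun v => x v = 1) = D := by ext v; simp [hxdef]
  simp [panLuF, sum_eq_card_filter_eq_one hx, hfilter, hcard, fun v => hpen v y rfl]

/-- The objective is at least the number of selected vertices plus `P` for every undominated
vertex, while the selected and the undominated vertices together form a dominating set. -/
theorem exists_card_add_mul_le_panLuF {P : ℝ} (hP : 0 ≤ P) (hx : ∀ v, x v = 0 ∨ x v = 1)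
    (hy : ∀ v k, y v k = 0 ∨ y v k = 1) :
    ∃ m : ℕ, ((Finset.univ.filter fun v => x v = 1).card : ℝ) + P * m ≤ panLuF G P x y ∧
      dominationNumber G ≤ (Finset.univ.filter fun v => x v = 1).card + m ∧
      (m = 0 → IsDominatingSet G (Finset.univ.filter fun v => x v = 1)) := by
  classical
  set D : Finset V := Finset.univ.filter fun v => x v = 1 with hDdef
  set U : Finset V := Finset.univ.filter fun v => ¬(v ∈ D ∨ ∃ u ∈ D, G.Adj v u) with hUdef
  have hzero : ∀ v, v ∉ D → x v = 0 := fun v hv =>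
    (hx v).resolve_right fun h => hv (by simp [hDdef, h])
  refine ⟨U.card, ?_, ?_, fun hU v => ?_⟩
  · rw [panLuF, sum_eq_card_filter_eq_one hx]
    gcongr
    rw [Finset.cast_card]
    refine (Finset.sum_le_sum fun v hv => ?_).trans
      (Finset.sum_le_sum_of_subset_of_nonneg (Finset.subset_univ U) fun v _ _ => ?_)
    · rw [hUdef, Finset.mem_filter, not_or] at hv
      exact_mod_cast one_le_panLuPenalty hy (hzero v hv.2.1)
        fun u hu => hzero u fun hmem => hv.2.2 ⟨u, hmem, hu⟩
    · exact_mod_cast panLuPenalty_nonneg v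
  · refine (dominationNumber_le_card (D := D ∪ U) fun v => ?_).trans (Finset.card_union_le D U)
    by_cases hv : v ∈ U
    · exact Or.inl (Finset.mem_union_right _ hv)
    · rw [hUdef, Finset.mem_filter, not_and, not_not] at hv
      exact (hv (Finset.mem_univ v)).imp (Finset.mem_union_left _)
        fun ⟨u, hu, hvu⟩ => ⟨u, Finset.mem_union_left _ hu, hvu⟩
  · by_contra hv
    exact Finset.notMem_empty v (Finset.card_eq_zero.mp hU ▸ by rw [hUdef]; simpa using hv)

end Penalty

/-- For a finite simple graph `G` and penalty coefficient
`P > 1`, the minimum of the Pan–Lu QUBO objective over all binary `(x, y)`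
equals the domination number `γ(G)`, and every minimizer's set `{v : x* v = 1}`
is a minimum dominating set of `G`. -/
theorem pan_lu_qubo_min {V : Type*} [Fintype V] [DecidableEq V]
    (G : SimpleGraph V) [DecidableRel G.Adj] (P : ℝ) (hP : 1 < P) :
    IsLeast {r : ℝ | ∃ (x : V → ℤ) (y : V → ℕ → ℤ),
        (∀ v, x v = 0 ∨ x v = 1) ∧ (∀ v k, y v k = 0 ∨ y v k = 1) ∧
        r = panLuF G P x y} ((dominationNumber G : ℝ)) ∧
      ∀ (x : V → ℤ) (y : V → ℕ → ℤ),
        (∀ v, x v = 0 ∨ x v = 1) → (∀ v k, y v k = 0 ∨ y v k = 1) →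
        panLuF G P x y = (dominationNumber G : ℝ) →
        IsDominatingSet G (Finset.univ.filter fun v => x v = 1) ∧
          (Finset.univ.filter fun v => x v = 1).card = dominationNumber G := by
  refine ⟨⟨?_, ?_⟩, fun x y hx hy hF => ?_⟩
  · obtain ⟨x, y, hx, hy, hF⟩ := exists_panLuF_eq_dominationNumber G P
    exact ⟨x, y, hx, hy, hF.symm⟩
  · rintro r ⟨x, y, hx, hy, rfl⟩
    obtain ⟨m, hle, hdom, -⟩ := exists_card_add_mul_le_panLuF (G := G) (P := P) (by linarith) hx hy
    have hdom' : (dominationNumber G : ℝ) ≤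
        (Finset.univ.filter fun v => x v = 1).card + m := by exact_mod_cast hdom
    nlinarith [m.cast_nonneg (α := ℝ)]
  · obtain ⟨m, hle, hdom, hD⟩ := exists_card_add_mul_le_panLuF (G := G) (P := P) (by linarith) hx hy
    have hdom' : (dominationNumber G : ℝ) ≤
        (Finset.univ.filter fun v => x v = 1).card + m := by exact_mod_cast hdom
    rw [hF] at hle
    have hm : m = 0 := by
      by_contra hm
      have hpos : (0 : ℝ) < m := by exact_mod_cast Nat.pos_of_ne_zero hm
      nlinarith
    subst hm
    refine ⟨hD rfl, le_antisymm ?_ (dominationNumber_le_card (hD rfl))⟩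
    have hle' : ((Finset.univ.filter fun v => x v = 1).card : ℝ) ≤ dominationNumber G := by
      simpa using hle
    exact_mod_cast hle'
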